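/- Let B = {1234, 1243, 1324, 1342, 1423, 2134, 2314, 2341, 3124, 4123}. Then |S_3(B)| = 6, and for every n ≥ 1 with n ≠ 3, |S_n(B)| equals the n-th Catalan number C_n = (1/(n+1))·binom(2n, n). (Equivalently, Σ_{n≥1} |S_n(B)| x^n = x³ − 1 + C(x), where C(x) = Σ_{n≥0} C_n x^n.) -/

import Mathlib

/-- `σ` contains the pattern `τ`. -/
def ContainsPat {n k : ℕ} (σ : Equiv.Perm (Fin n)) (τ : Equiv.Perm (Fin k)) : Prop :=
  ∃ f : Fin k → Fin n, StrictMono f ∧ ∀ a b : Fin k, σ (f a) < σ (f b) ↔ τ a < τ b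

/-- `σ` avoids every pattern in the set `B`. -/
def AvoidsAll {n : ℕ} (B : Set (Σ k, Equiv.Perm (Fin k))) (σ : Equiv.Perm (Fin n)) : Prop :=
  ∀ p ∈ B, ¬ ContainsPat σ p.2

/-- The pattern 1234 (0-based one-line notation). -/
noncomputable def p1234 : Equiv.Perm (Fin 4) :=
  Equiv.ofBijective ![0, 1, 2, 3] (by decide)

/-- The pattern 1243 (0-based one-line notation). -/
noncomputable def p1243 : Equiv.Perm (Fin 4) :=
  Equiv.ofBijective ![0, 1, 3, 2] (by decide)

/-- The pattern 1324 (0-based one-line notation). -/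
noncomputable def p1324 : Equiv.Perm (Fin 4) :=
  Equiv.ofBijective ![0, 2, 1, 3] (by decide)

/-- The pattern 1342 (0-based one-line notation). -/
noncomputable def p1342 : Equiv.Perm (Fin 4) :=
  Equiv.ofBijective ![0, 2, 3, 1] (by decide)

/-- The pattern 1423 (0-based one-line notation). -/
noncomputable def p1423 : Equiv.Perm (Fin 4) :=
  Equiv.ofBijective ![0, 3, 1, 2] (by decide)

/-- The pattern 2134 (0-based one-line notation). -/
noncomputable def p2134 : Equiv.Perm (Fin 4) :=
  Equiv.ofBijective ![1, 0, 2, 3] (by decide)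

/-- The pattern 2314 (0-based one-line notation). -/
noncomputable def p2314 : Equiv.Perm (Fin 4) :=
  Equiv.ofBijective ![1, 2, 0, 3] (by decide)

/-- The pattern 2341 (0-based one-line notation). -/
noncomputable def p2341 : Equiv.Perm (Fin 4) :=
  Equiv.ofBijective ![1, 2, 3, 0] (by decide)

/-- The pattern 3124 (0-based one-line notation). -/
noncomputable def p3124 : Equiv.Perm (Fin 4) :=
  Equiv.ofBijective ![2, 0, 1, 3] (by decide)

/-- The pattern 4123 (0-based one-line notation). -/
noncomputable def p4123 : Equiv.Perm (Fin 4) :=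
  Equiv.ofBijective ![3, 0, 1, 2] (by decide)

noncomputable def a18 (n : ℕ) : ℕ :=
  Nat.card {σ : Equiv.Perm (Fin n) //
    AvoidsAll ({⟨4, p1234⟩, ⟨4, p1243⟩, ⟨4, p1324⟩, ⟨4, p1342⟩, ⟨4, p1423⟩, ⟨4, p2134⟩, ⟨4, p2314⟩, ⟨4, p2341⟩, ⟨4, p3124⟩, ⟨4, p4123⟩} : Set (Σ k, Equiv.Perm (Fin k))) σ}

/-- `σ` avoids 123 and all its (non-consecutive) ascent bottoms are `< t`. -/
def Good {n : ℕ} (σ : Equiv.Perm (Fin n)) (t : ℕ) : Prop :=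
  (∀ i j k, i < j → j < k → σ i < σ j → σ j < σ k → False) ∧
    ∀ i j, i < j → σ i < σ j → (σ i : ℕ) < t

/-- Prepend the value `p` to the permutation `s`. -/
noncomputable def ins {n : ℕ} (p : Fin (n + 1)) (s : Equiv.Perm (Fin n)) :
    Equiv.Perm (Fin (n + 1)) :=
  Equiv.ofBijective (Fin.cons p (fun i => p.succAbove (s i)))
    (Finite.injective_iff_bijective.mp (by
      rw [Fin.cons_injective_iff]
      refine ⟨?_, ?_⟩
      · rintro ⟨i, hi⟩
        exact Fin.succAbove_ne _ _ hi
      · intro i j h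
        exact s.injective (Fin.succAbove_right_injective h)))

theorem ins_zero {n : ℕ} (p : Fin (n + 1)) (s : Equiv.Perm (Fin n)) : ins p s 0 = p := rfl

theorem ins_succ {n : ℕ} (p : Fin (n + 1)) (s : Equiv.Perm (Fin n)) (i : Fin n) :
    ins p s i.succ = p.succAbove (s i) := rfl

theorem ins_bijective (n : ℕ) :
    Function.Bijective (fun x : Fin (n + 1) × Equiv.Perm (Fin n) => ins x.1 x.2) := by
  rw [Fintype.bijective_iff_injective_and_card]
  constructor
  · rintro ⟨p, s⟩ ⟨q, r⟩ h
    have h' : ins p s = ins q r := h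
    have h0 : p = q := by
      have := congrArg (fun e => e 0) h'
      simpa [ins_zero] using this
    subst h0
    have : s = r := by
      ext1 i
      have := congrArg (fun e => e i.succ) h'
      simpa [ins_succ] using this
    rw [this]
  · simp [Fintype.card_perm, Nat.factorial_succ]

theorem lt_succAbove_val {n : ℕ} (p : Fin (n + 1)) (v : Fin n) :
    p < p.succAbove v ↔ (p : ℕ) ≤ v := by
  rw [Fin.lt_succAbove_iff_le_castSucc, Fin.le_def, Fin.val_castSucc]

theorem good_ins {n : ℕ} (p : Fin (n + 1)) (s : Equiv.Perm (Fin n)) (t : ℕ) (ht : t ≤ n) :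
    Good (ins p s) t ↔ ((p : ℕ) < t ∧ Good s p) ∨ ((p : ℕ) = n ∧ Good s t) := by
  have key : Good (ins p s) t ↔ Good s p ∧ (∀ j, (p : ℕ) ≤ s j → (p : ℕ) < t) ∧
      ∀ i j, i < j → s i < s j → (p.succAbove (s i) : ℕ) < t := by
    constructor
    · rintro ⟨h1, h2⟩
      refine ⟨⟨?_, ?_⟩, ?_, ?_⟩
      · intro i j k hij hjk h h'
        refine h1 i.succ j.succ k.succ (by simpa) (by simpa) ?_ ?_ <;> simpa [ins_succ]
      · intro i j hij h
        by_contra hc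
        refine h1 0 i.succ j.succ (Fin.succ_pos _) (by simpa) ?_ ?_
        · rw [ins_zero, ins_succ, lt_succAbove_val]; omega
        · simpa [ins_succ]
      · intro j hj
        have := h2 0 j.succ (Fin.succ_pos _)
        rw [ins_zero, ins_succ, lt_succAbove_val] at this
        exact this hj
      · intro i j hij h
        have := h2 i.succ j.succ (by simpa) (by simpa [ins_succ])
        simpa [ins_succ] using this
    · rintro ⟨⟨h1, h2⟩, h3, h4⟩
      refine ⟨?_, ?_⟩
      · intro i j k hij hjk
        cases j using Fin.cases with
        | zero => simp at hij
        | succ j =>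
        cases k using Fin.cases with
        | zero => simp at hjk
        | succ k =>
        cases i using Fin.cases with
        | zero =>
          rw [ins_zero, ins_succ, ins_succ, lt_succAbove_val, Fin.succAbove_lt_succAbove_iff]
          intro a b
          have := h2 j k (by simpa using hjk) b
          omega
        | succ i =>
          simp only [ins_succ, Fin.succAbove_lt_succAbove_iff]
          exact h1 i j k (by simpa using hij) (by simpa using hjk)
      · intro i j hij
        cases j using Fin.cases with
        | zero => simp at hij
        | succ j =>
        cases i using Fin.cases with
        | zero =>
          rw [ins_zero, ins_succ, lt_succAbove_val]
          exact h3 j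
        | succ i =>
          simp only [ins_succ, Fin.succAbove_lt_succAbove_iff]
          exact h4 i j (by simpa using hij)
  rw [key]
  have low : ∀ v : Fin n, (v : ℕ) < p → (p.succAbove v : ℕ) = v := by
    intro v hv
    rw [Fin.succAbove_of_castSucc_lt _ _ (by rw [Fin.lt_def]; simpa using hv)]
    simp
  constructor
  · rintro ⟨hs, h3, h4⟩
    by_cases hp : (p : ℕ) = n
    · right
      refine ⟨hp, hs.1, ?_⟩
      intro i j hij h
      have := h4 i j hij h
      rwa [low _ (hs.2 i j hij h)] at this
    · left
      refine ⟨?_, hs⟩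
      have hpn : (p : ℕ) < n := by have := p.isLt; omega
      exact h3 (s.symm ⟨p, hpn⟩) (by simp)
  · rintro (⟨hp, hs⟩ | ⟨hp, hs⟩)
    · refine ⟨hs, fun _ _ => hp, ?_⟩
      intro i j hij h
      have := hs.2 i j hij h
      rw [low _ this]; omega
    · refine ⟨⟨hs.1, ?_⟩, ?_, ?_⟩
      · intro i j _ _
        have := (s i).isLt
        omega
      · intro j hj
        have := (s j).isLt
        omega
      · intro i j hij h
        rw [low _ (by have := (s i).isLt; omega)]
        exact hs.2 i j hij h

noncomputable def F (n t : ℕ) : ℕ := Nat.card {σ : Equiv.Perm (Fin n) // Good σ t}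

theorem F_zero (t : ℕ) : F 0 t = 1 := by
  unfold F
  rw [Nat.card_eq_one_iff_unique]
  refine ⟨⟨fun a b => Subtype.ext (Subsingleton.elim _ _)⟩, ⟨⟨1, ?_, ?_⟩⟩⟩
  · intro i; exact i.elim0
  · intro i; exact i.elim0

theorem F_last (n : ℕ) : F (n + 1) (n + 1) = F (n + 1) n := by
  unfold F
  congr 1
  congr 1
  funext σ
  apply propext
  refine and_congr_right fun _ => forall₄_congr fun i j hij h => ?_
  have h1 := (σ j).isLt
  have : (σ i : ℕ) < σ j := h
  omega

theorem F_rec (n t : ℕ) (ht : t ≤ n) :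
    F (n + 1) t = ∑ p ∈ Finset.range (t + 1), F n p := by
  classical
  have h1 : F (n + 1) t = ∑ p : Fin (n + 1), Nat.card {s : Equiv.Perm (Fin n) // Good (ins p s) t} := by
    rw [← Nat.card_sigma]
    unfold F
    refine (Nat.card_congr ?_).symm
    refine (Equiv.subtypeProdEquivSigmaSubtype
      (fun (p : Fin (n+1)) (s : Equiv.Perm (Fin n)) => Good (ins p s) t)).symm.trans ?_
    exact (Equiv.ofBijective _ (ins_bijective n)).subtypeEquiv (fun _ => Iff.rfl)
  rw [h1, Fin.sum_univ_castSucc, Finset.sum_range_succ]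
  congr 1
  · have h2 : ∀ p : Fin n, Nat.card {s : Equiv.Perm (Fin n) // Good (ins p.castSucc s) t}
        = if (p : ℕ) < t then F n p else 0 := by
      intro p
      have hp := p.isLt
      split_ifs with h
      · unfold F
        refine Nat.card_congr (Equiv.subtypeEquivRight fun s => ?_)
        rw [good_ins _ _ _ ht, Fin.val_castSucc]
        constructor
        · rintro (h | h)
          · exact h.2
          · omega
        · intro h'; exact Or.inl ⟨h, h'⟩
      · have : IsEmpty {s : Equiv.Perm (Fin n) // Good (ins p.castSucc s) t} := by
          refine ⟨fun s => ?_⟩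
          have := s.2
          rw [good_ins _ _ _ ht, Fin.val_castSucc] at this
          omega
        exact Nat.card_of_isEmpty
    simp_rw [h2]
    rw [Fin.sum_univ_eq_sum_range (fun p => if p < t then F n p else 0) n,
      ← Finset.sum_filter]
    refine Finset.sum_congr ?_ fun _ _ => rfl
    ext x
    simp only [Finset.mem_filter, Finset.mem_range]
    omega
  · unfold F
    refine Nat.card_congr (Equiv.subtypeEquivRight fun s => ?_)
    rw [good_ins _ _ _ ht, Fin.val_last]
    constructor
    · rintro (h | h)
      · omega
      · exact h.2
    · intro h'; exact Or.inr ⟨rfl, h'⟩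

theorem choose_aux (n t : ℕ) :
    (t + 1) * (n + (t + 1)).choose (t + 1) = (n + t + 1) * (n + t).choose t := by
  have := Nat.add_one_mul_choose_eq (n + t) t
  rw [← add_assoc]
  linarith

theorem choose_aux' (n t : ℕ) :
    (n + 1) * (n + 1 + t).choose t = (n + t + 1) * (n + t).choose t := by
  have h := Nat.add_one_mul_choose_eq (n + t) n
  rw [Nat.choose_symm_add] at h
  rw [h, show n + t + 1 = n + 1 + t by ring, Nat.choose_symm_add]
  ring

theorem F_formula (n : ℕ) : ∀ t ≤ n, (n + 1) * F n t + t * (n + t).choose t = (n + 1) * (n + t).choose t := by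
  induction n with
  | zero =>
    intro t ht
    obtain rfl : t = 0 := by omega
    simp [F_zero]
  | succ n ih =>
    have main : ∀ t ≤ n, (n + 2) * F (n + 1) t + t * (n + 1 + t).choose t
        = (n + 2) * (n + 1 + t).choose t := by
      intro t
      induction t with
      | zero =>
        intro _
        have := ih 0 (by omega)
        simp only [F_rec n 0 (by omega), zero_add, Finset.sum_range_one]
        simp at this ⊢
        exact this
      | succ t iht =>
        intro ht
        have e1 := iht (by omega)
        have e2 := ih (t + 1) ht
        rw [F_rec n _ ht, Finset.sum_range_succ, ← F_rec n t (by omega)]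
        have a := choose_aux n t
        have b := choose_aux' n t
        have c := choose_aux (n + 1) t
        have d := choose_aux' n (t + 1)
        generalize F (n + 1) t = x at *
        generalize F n (t + 1) = y at *
        generalize (n + t).choose t = A at *
        generalize (n + (t + 1)).choose (t + 1) = B at *
        generalize (n + 1 + t).choose t = C at *
        generalize (n + 1 + (t + 1)).choose (t + 1) = D at *
        zify at *
        have hn : ((n : ℤ) + 1) ≠ 0 := by positivity
        apply mul_left_cancel₀ hn
        linear_combination ((n : ℤ) + 1) * e1 + ((n : ℤ) + 2) * e2 + ((n : ℤ) + 2 - t) * (b - a)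
          - ((n : ℤ) + 1 - t) * d
    intro t ht
    rcases Nat.lt_or_ge n t with h | h
    · obtain rfl : t = n + 1 := by omega
      have := main n le_rfl
      rw [F_last]
      have c := choose_aux (n + 1) n
      have d : (n + 1 + (n + 1)).choose (n + 1) = 2 * (n + 1 + n).choose n := by
        apply Nat.eq_of_mul_eq_mul_left (Nat.succ_pos n)
        rw [Nat.succ_eq_add_one, c]; ring
      rw [d]
      linarith
    · exact main t h

/-- Increasing subsequence of length three. -/
def Has123 {n : ℕ} (σ : Equiv.Perm (Fin n)) : Prop :=
  ∃ i j k, i < j ∧ j < k ∧ σ i < σ j ∧ σ j < σ k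

theorem contains_of {n : ℕ} {σ : Equiv.Perm (Fin n)} (τ : Equiv.Perm (Fin 4))
    (g : Fin 4 → Fin 4) (hg : ∀ x, g (τ x) = x) {a b c d : Fin n} (hab : a < b) (hbc : b < c)
    (hcd : c < d)
    (h : σ (![a, b, c, d] (g 0)) < σ (![a, b, c, d] (g 1)) ∧
      σ (![a, b, c, d] (g 1)) < σ (![a, b, c, d] (g 2)) ∧
      σ (![a, b, c, d] (g 2)) < σ (![a, b, c, d] (g 3))) : ContainsPat σ τ := by
  refine ⟨![a, b, c, d], ?_, ?_⟩
  · rw [Fin.strictMono_iff_lt_succ]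
    intro i
    fin_cases i <;> simpa
  · have hm : StrictMono (fun x => σ (![a, b, c, d] (g x))) := by
      rw [Fin.strictMono_iff_lt_succ]
      intro i
      fin_cases i
      exacts [h.1, h.2.1, h.2.2]
    intro x y
    have := hm.lt_iff_lt (a := τ x) (b := τ y)
    simpa only [hg] using this

theorem has123_of {n : ℕ} {σ : Equiv.Perm (Fin n)} {τ : Equiv.Perm (Fin 4)} (i j k : Fin 4)
    (hij : i < j) (hjk : j < k) (h1 : τ i < τ j) (h2 : τ j < τ k) (h : ContainsPat σ τ) :
    Has123 σ := by
  obtain ⟨f, hf, h⟩ := h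
  exact ⟨f i, f j, f k, hf hij, hf hjk, (h _ _).2 h1, (h _ _).2 h2⟩

theorem avoids_iff {n : ℕ} (hn : 4 ≤ n) (σ : Equiv.Perm (Fin n)) :
    AvoidsAll ({⟨4, p1234⟩, ⟨4, p1243⟩, ⟨4, p1324⟩, ⟨4, p1342⟩, ⟨4, p1423⟩, ⟨4, p2134⟩, ⟨4, p2314⟩, ⟨4, p2341⟩, ⟨4, p3124⟩, ⟨4, p4123⟩} : Set (Σ k, Equiv.Perm (Fin k))) σ
    ↔ ¬ Has123 σ := by
  simp only [AvoidsAll, Set.mem_insert_iff, Set.mem_singleton_iff, forall_eq_or_imp, forall_eq]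
  constructor
  · rintro ⟨h1, h2, h3, h4, h5, h6, h7, h8, h9, h10⟩ ⟨i, j, k, hij, hjk, vij, vjk⟩
    obtain ⟨l, hl⟩ : ∃ l : Fin n, l ∉ ({i, j, k} : Finset (Fin n)) := by
      by_contra hc
      push Not at hc
      have := Finset.card_le_card (fun x _ => hc x : (Finset.univ : Finset (Fin n)) ⊆ _)
      have h3 := Finset.card_le_three (a := i) (b := j) (c := k)
      simp only [Finset.card_univ, Fintype.card_fin] at this
      omega
    simp only [Finset.mem_insert, Finset.mem_singleton, not_or] at hl
    obtain ⟨li, lj, lk⟩ := hl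
    have vi : σ l ≠ σ i := fun h => li (σ.injective h)
    have vj : σ l ≠ σ j := fun h => lj (σ.injective h)
    have vk : σ l ≠ σ k := fun h => lk (σ.injective h)
    rcases lt_or_gt_of_ne li with pi | pi
    · rcases lt_or_gt_of_ne vi with qi | qi
      · exact h1 (contains_of p1234 ![0, 1, 2, 3] (by decide +revert) pi hij hjk ⟨qi, vij, vjk⟩)
      rcases lt_or_gt_of_ne vj with qj | qj
      · exact h6 (contains_of p2134 ![1, 0, 2, 3] (by decide +revert) pi hij hjk ⟨qi, qj, vjk⟩)
      rcases lt_or_gt_of_ne vk with qk | qk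
      · exact h9 (contains_of p3124 ![1, 2, 0, 3] (by decide +revert) pi hij hjk ⟨vij, qj, qk⟩)
      · exact h10 (contains_of p4123 ![1, 2, 3, 0] (by decide +revert) pi hij hjk ⟨vij, vjk, qk⟩)
    rcases lt_or_gt_of_ne lj with pj | pj
    · rcases lt_or_gt_of_ne vi with qi | qi
      · exact h6 (contains_of p2134 ![1, 0, 2, 3] (by decide +revert) pi pj hjk ⟨qi, vij, vjk⟩)
      rcases lt_or_gt_of_ne vj with qj | qj
      · exact h1 (contains_of p1234 ![0, 1, 2, 3] (by decide +revert) pi pj hjk ⟨qi, qj, vjk⟩)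
      rcases lt_or_gt_of_ne vk with qk | qk
      · exact h3 (contains_of p1324 ![0, 2, 1, 3] (by decide +revert) pi pj hjk ⟨vij, qj, qk⟩)
      · exact h5 (contains_of p1423 ![0, 2, 3, 1] (by decide +revert) pi pj hjk ⟨vij, vjk, qk⟩)
    rcases lt_or_gt_of_ne lk with pk | pk
    · rcases lt_or_gt_of_ne vi with qi | qi
      · exact h7 (contains_of p2314 ![2, 0, 1, 3] (by decide +revert) hij pj pk ⟨qi, vij, vjk⟩)
      rcases lt_or_gt_of_ne vj with qj | qj
      · exact h3 (contains_of p1324 ![0, 2, 1, 3] (by decide +revert) hij pj pk ⟨qi, qj, vjk⟩)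
      rcases lt_or_gt_of_ne vk with qk | qk
      · exact h1 (contains_of p1234 ![0, 1, 2, 3] (by decide +revert) hij pj pk ⟨vij, qj, qk⟩)
      · exact h2 (contains_of p1243 ![0, 1, 3, 2] (by decide +revert) hij pj pk ⟨vij, vjk, qk⟩)
    · rcases lt_or_gt_of_ne vi with qi | qi
      · exact h8 (contains_of p2341 ![3, 0, 1, 2] (by decide +revert) hij hjk pk ⟨qi, vij, vjk⟩)
      rcases lt_or_gt_of_ne vj with qj | qj
      · exact h4 (contains_of p1342 ![0, 3, 1, 2] (by decide +revert) hij hjk pk ⟨qi, qj, vjk⟩)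
      rcases lt_or_gt_of_ne vk with qk | qk
      · exact h2 (contains_of p1243 ![0, 1, 3, 2] (by decide +revert) hij hjk pk ⟨vij, qj, qk⟩)
      · exact h1 (contains_of p1234 ![0, 1, 2, 3] (by decide +revert) hij hjk pk ⟨vij, vjk, qk⟩)
  · intro h
    refine ⟨?_, ?_, ?_, ?_, ?_, ?_, ?_, ?_, ?_, ?_⟩ <;> intro hc <;> apply h
    · exact has123_of 0 1 2 (by decide) (by decide) (by decide) (by decide) hc
    · exact has123_of 0 1 2 (by decide) (by decide) (by decide) (by decide) hc
    · exact has123_of 0 1 3 (by decide) (by decide) (by decide) (by decide) hc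
    · exact has123_of 0 1 2 (by decide) (by decide) (by decide) (by decide) hc
    · exact has123_of 0 2 3 (by decide) (by decide) (by decide) (by decide) hc
    · exact has123_of 0 2 3 (by decide) (by decide) (by decide) (by decide) hc
    · exact has123_of 0 1 3 (by decide) (by decide) (by decide) (by decide) hc
    · exact has123_of 0 1 2 (by decide) (by decide) (by decide) (by decide) hc
    · exact has123_of 1 2 3 (by decide) (by decide) (by decide) (by decide) hc
    · exact has123_of 1 2 3 (by decide) (by decide) (by decide) (by decide) hc

theorem good_top {n : ℕ} (σ : Equiv.Perm (Fin n)) : Good σ n ↔ ¬ Has123 σ := by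
  constructor
  · rintro ⟨h, _⟩ ⟨i, j, k, a, b, c, d⟩
    exact h i j k a b c d
  · intro h
    exact ⟨fun i j k a b c d => h ⟨i, j, k, a, b, c, d⟩, fun i _ _ _ => (σ i).isLt⟩

theorem a18_small {n : ℕ} (hn : n < 4) : a18 n = n.factorial := by
  unfold a18
  rw [Nat.card_congr (Equiv.subtypeUnivEquiv ?_)]
  · rw [Nat.card_eq_fintype_card, Fintype.card_perm, Fintype.card_fin]
  · intro σ
    have : ∀ τ : Equiv.Perm (Fin 4), ¬ ContainsPat σ τ := by
      rintro τ ⟨f, hf, _⟩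
      have := Fintype.card_le_of_injective f hf.injective
      simp at this
      omega
    simp only [AvoidsAll, Set.mem_insert_iff, Set.mem_singleton_iff, forall_eq_or_imp, forall_eq]
    simp [this]

theorem card_avoiders_ten_patterns_B10 :
    a18 3 = 6 ∧ ∀ n : ℕ, 1 ≤ n → n ≠ 3 → (n + 1) * a18 n = Nat.choose (2 * n) n := by
  refine ⟨a18_small (by norm_num), ?_⟩
  intro n h1 h3
  rcases Nat.lt_or_ge n 4 with h | h
  · rw [a18_small h]
    interval_cases n
    · decide
    · decide
    · omega
  · have e : a18 n = F n n := by
      unfold a18 F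
      refine Nat.card_congr (Equiv.subtypeEquivRight fun s => ?_)
      rw [avoids_iff h, good_top]
    have := F_formula n n le_rfl
    rw [e, two_mul]
    linarith
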